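/- Let {A_t, B_t}_{t≥0} be a growth competition between p and q on a complete Riemannian manifold M. Then B_∞ = Ω and A_∞ = M∖Ω. -/

import Mathlib

/-!
Formalization framework for "growth competitions" (after the paper's
Section 2), at the metric-space level.

Since Mathlib does not yet have Riemannian metrics, a complete Riemannian
manifold is represented by a proper (hence complete; Hopf-Rinow) metric
space whose distance is the induced length (intrinsic) metric, and
spherical symmetry about `p` with warping function `G` is expressed through
global geodesic polar normal coordinates `Φ : ℝⁿ ≃ M` with `Φ 0 = p` and
`dist (Φ x) p = ‖x‖`, in which the Riemannian distance is the infimum of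
lengths of Lipschitz curves measured in the warped metric
`g = dr² + G(r)² dθ²`.
-/

open Set Metric Filter MeasureTheory InnerProductGeometry NNReal ENNReal
open scoped RealInnerProductSpace Classical

noncomputable section

namespace GrowthComp

variable {M : Type*} [MetricSpace M]

/-- Length of the path `γ : ℝ → M` over the time interval `[0, T]`
(the total variation of `γ` on `[0, T]`, valued in `ℝ≥0∞`). -/
def pathLength (γ : ℝ → M) (T : ℝ) : ℝ≥0∞ := eVariationOn γ (Set.Icc 0 T)

/-- The intrinsic metric `d_S` of `M ∖ S`: the infimum of lengths of Lipschitz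
paths from `x` to `y` avoiding `S` (with `sInf ∅ = ∞`). -/
def dCompl (S : Set M) (x y : M) : ℝ≥0∞ :=
  sInf {L : ℝ≥0∞ | ∃ (T : ℝ) (γ : ℝ → M), 0 ≤ T ∧ γ 0 = x ∧ γ T = y ∧
    (∃ K : ℝ≥0, LipschitzOnWith K γ (Set.Icc 0 T)) ∧
    (∀ t ∈ Set.Icc 0 T, γ t ∉ S) ∧ L = pathLength γ T}

/-- The distance of `M` is the induced length metric (true for every
complete Riemannian manifold). -/
def IsLengthSpace (M : Type*) [MetricSpace M] : Prop :=
  ∀ x y : M, ENNReal.ofReal (dist x y) = dCompl (∅ : Set M) x y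

/-- A path `γ : [0, T] → M` *avoids* the (time-indexed) family `B`:
it starts at `q`, is `λ`-Lipschitz, and `γ s ∉ B s` for all `s ∈ [0, T]`. -/
def AvoidsB (q : M) (lam : ℝ) (B : ℝ → Set M) (T : ℝ) (γ : ℝ → M) : Prop :=
  γ 0 = q ∧ LipschitzOnWith (Real.toNNReal lam) γ (Set.Icc 0 T) ∧
    ∀ s ∈ Set.Icc 0 T, γ s ∉ B s

/-- A path `η : [0, T] → M` *avoids* the family `A`:
it starts at `p`, is `1`-Lipschitz, and `η s ∉ A s` for all `s ∈ [0, T]`. -/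
def AvoidsA (p : M) (A : ℝ → Set M) (T : ℝ) (η : ℝ → M) : Prop :=
  η 0 = p ∧ LipschitzOnWith 1 η (Set.Icc 0 T) ∧ ∀ s ∈ Set.Icc 0 T, η s ∉ A s

/-- `{A_t, B_t}_{t ≥ 0}` is a *growth competition* between `p` and `q` with
speed ratio `λ`: both families are increasing, `A 0 = {q}`, `B 0 = {p}`, and
for `t > 0`, `A t` is the union of `γ([0,t])` over paths `γ` avoiding `B`
and `B t` is the union of `η([0,t))` over paths `η` avoiding `A`. -/
structure IsGrowthCompetition (p q : M) (lam : ℝ) (A B : ℝ → Set M) : Prop where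
  monoA : ∀ ⦃t₁ t₂ : ℝ⦄, 0 ≤ t₁ → t₁ ≤ t₂ → A t₁ ⊆ A t₂
  monoB : ∀ ⦃t₁ t₂ : ℝ⦄, 0 ≤ t₁ → t₁ ≤ t₂ → B t₁ ⊆ B t₂
  A_zero : A 0 = {q}
  B_zero : B 0 = {p}
  A_eq : ∀ t : ℝ, 0 < t →
    A t = {x | ∃ γ : ℝ → M, AvoidsB q lam B t γ ∧ x ∈ γ '' Set.Icc 0 t}
  B_eq : ∀ t : ℝ, 0 < t →
    B t = {x | ∃ η : ℝ → M, AvoidsA p A t η ∧ x ∈ η '' Set.Ico 0 t}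

/-- `A_∞ = ⋃_{t ≥ 0} A_t`. -/
def Ainfty (A : ℝ → Set M) : Set M := ⋃ t ∈ Set.Ici (0 : ℝ), A t

/-- `B_∞ = ⋃_{t ≥ 0} B_t`. -/
def Binfty (B : ℝ → Set M) : Set M := ⋃ t ∈ Set.Ici (0 : ℝ), B t

/-- The recursively defined sets `Ω_n`:
`Ω_0 = ∅`, `Ω_{n+1} = Ω_n ∪ {x ∈ M ∖ Ω_n | d_{Ω_n}(x, q) > λ d(x, p)}`. -/
def OmegaSeq (p q : M) (lam : ℝ) : ℕ → Set M
  | 0 => ∅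
  | n + 1 => OmegaSeq p q lam n ∪
      {x | x ∉ OmegaSeq p q lam n ∧
        ENNReal.ofReal (lam * dist x p) < dCompl (OmegaSeq p q lam n) x q}

/-- `Ω = ⋃_{n ≥ 1} Ω_n`. -/
def Omega (p q : M) (lam : ℝ) : Set M := ⋃ n : ℕ, OmegaSeq p q lam (n + 1)

/-- `γ` is a unit-speed minimizing geodesic from `x` to `y`, parametrized on
`[0, dist x y]`. -/
def IsMinGeodesicFromTo (γ : ℝ → M) (x y : M) : Prop :=
  γ 0 = x ∧ γ (dist x y) = y ∧
    ∀ s ∈ Set.Icc (0 : ℝ) (dist x y), ∀ t ∈ Set.Icc (0 : ℝ) (dist x y),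
      dist (γ s) (γ t) = |s - t|

/-- `S` is star-shaped about `p`: every minimizing geodesic from `p` to a
point of `S` lies inside `S`. -/
def StarShapedAbout (p : M) (S : Set M) : Prop :=
  ∀ x ∈ S, ∀ γ : ℝ → M, IsMinGeodesicFromTo γ p x →
    ∀ t ∈ Set.Icc (0 : ℝ) (dist p x), γ t ∈ S

/-- `x` is *visible* from `q` through the obstacle `S`: no minimizing
geodesic joining `q` and `x` intersects `S`.  (On a nonpositively curved
simply connected manifold minimizing geodesics are unique, so this matches
"the minimizing geodesic joining `q` and `x` does not intersect `S`".) -/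
def VisibleThrough (S : Set M) (q x : M) : Prop :=
  ∀ γ : ℝ → M, IsMinGeodesicFromTo γ q x →
    ∀ t ∈ Set.Icc (0 : ℝ) (dist q x), γ t ∉ S

/-! ### Spherically symmetric manifolds, via polar normal coordinates -/

/-- Euclidean `n`-space, the model space for polar normal coordinates. -/
abbrev Euc (n : ℕ) : Type := EuclideanSpace ℝ (Fin n)

/-- The norm of the tangent vector `v` at the point `x ∈ ℝⁿ ∖ {0}` in the
spherically symmetric (warped product) metric `g = dr² + G(r)² dθ²`:
`g_x(v,v) = ⟨v, x̂⟩² + (G(‖x‖)²/‖x‖²) (‖v‖² − ⟨v, x̂⟩²)`. -/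
def warpNorm {n : ℕ} (G : ℝ → ℝ) (x v : Euc n) : ℝ :=
  if x = 0 then ‖v‖
  else Real.sqrt (⟪v, ‖x‖⁻¹ • x⟫ ^ 2 +
    (G ‖x‖ / ‖x‖) ^ 2 * (‖v‖ ^ 2 - ⟪v, ‖x‖⁻¹ • x⟫ ^ 2))

/-- The length of a (Lipschitz, hence a.e. differentiable) curve `c` on
`[0, T]` in the warped metric `dr² + G(r)² dθ²`. -/
def warpLength {n : ℕ} (G : ℝ → ℝ) (c : ℝ → Euc n) (T : ℝ) : ℝ≥0∞ :=
  ∫⁻ t in Set.Icc (0 : ℝ) T, ENNReal.ofReal (warpNorm G (c t) (deriv c t))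

/-- `G` is an admissible warping function: positive and smooth on `(0,∞)`,
with `G(r) → 0` and `G(r)/r → 1` as `r → 0⁺`. -/
def IsWarping (G : ℝ → ℝ) : Prop :=
  (∀ r : ℝ, 0 < r → 0 < G r) ∧ ContDiffOn ℝ (⊤ : ℕ∞) G (Set.Ioi 0) ∧
    Tendsto G (nhdsWithin 0 (Set.Ioi 0)) (nhds 0) ∧
    Tendsto (fun r => G r / r) (nhdsWithin 0 (Set.Ioi 0)) (nhds 1)

/-- `Φ : ℝⁿ ≃ M` realizes `M` as spherically symmetric about `p` with
warping function `G`: `Φ` is a global geodesic polar normal coordinate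
chart — `Φ 0 = p` and the radial coordinate is the distance to `p` — and
the Riemannian distance of `M` is the infimum of warped lengths of
Lipschitz curves computed in the chart. -/
def IsSphericallySymmetric {n : ℕ} (p : M) (G : ℝ → ℝ) (Φ : Euc n ≃ M) : Prop :=
  IsWarping G ∧ Φ 0 = p ∧ (∀ x : Euc n, dist (Φ x) p = ‖x‖) ∧
    ∀ x y : Euc n, ENNReal.ofReal (dist (Φ x) (Φ y)) =
      sInf {L : ℝ≥0∞ | ∃ (T : ℝ) (c : ℝ → Euc n), 0 ≤ T ∧ c 0 = x ∧ c T = y ∧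
        (∃ K : ℝ≥0, LipschitzOnWith K c (Set.Icc 0 T)) ∧ L = warpLength G c T}

/-- The angular polar coordinate `θ(x) ∈ S_pM ≅ S^{n-1}` of a point
`x ≠ p`, read off through the polar chart `Φ`. -/
def polarTheta {n : ℕ} {M : Type*} [MetricSpace M] (Φ : Euc n ≃ M) (x : M) : Euc n :=
  ‖Φ.symm x‖⁻¹ • Φ.symm x

/-- Nonpositive sectional curvature for the spherically symmetric metric
`dr² + G(r)² dθ²`: the radial sectional curvature is `−G''/G ≤ 0`,
i.e. `G` is convex, and the tangential one is `(1 − G'²)/G² ≤ 0`,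
i.e. `G' ≥ 1`. -/
def NonposCurvWarping (G : ℝ → ℝ) : Prop :=
  ConvexOn ℝ (Set.Ioi 0) G ∧ ∀ r : ℝ, 0 < r → 1 ≤ deriv G r

/-- `∫₁^∞ dr / G(r) = ∞`.  For a surface of revolution this is, by a theorem
of Milnor cited in the paper, equivalent to parabolicity, i.e. conformal
equivalence to the Euclidean plane. -/
def ParabolicWarping (G : ℝ → ℝ) : Prop :=
  ∫⁻ r in Set.Ici (1 : ℝ), ENNReal.ofReal ((G r)⁻¹) = ⊤

/-- `∫₁^∞ dr / G(r) < ∞`.  For a surface of revolution this is, by a theorem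
of Milnor cited in the paper, equivalent to hyperbolicity, i.e. conformal
equivalence to the hyperbolic plane. -/
def HyperbolicWarping (G : ℝ → ℝ) : Prop :=
  ∫⁻ r in Set.Ici (1 : ℝ), ENNReal.ofReal ((G r)⁻¹) < ⊤

/-- There is a unit-speed path (a globally defined `1`-Lipschitz map) from `x` to `y`
that takes time `L` and avoids `S`. -/
def UnitPath (S : Set M) (x y : M) (L : ℝ) : Prop :=
  ∃ f : ℝ → M, LipschitzWith 1 f ∧ f 0 = x ∧ f L = y ∧ ∀ t, f t ∉ S

/-- To join two points by a unit path it suffices to give a path on a compact interval. -/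
theorem UnitPath.of_Icc {S : Set M} {f : ℝ → M} {a b : ℝ} (hab : a ≤ b)
    (hf : LipschitzOnWith 1 f (Icc a b)) (hS : ∀ t ∈ Icc a b, f t ∉ S) :
    UnitPath S (f a) (f b) (b - a) := by
  refine ⟨fun t => f (projIcc a b hab (a + t)), ?_, ?_, ?_, fun t => hS _ (projIcc _ _ _ _).2⟩
  · refine LipschitzWith.of_dist_le_mul fun s t => ?_
    refine (hf.dist_le_mul _ (projIcc _ _ hab _).2 _ (projIcc _ _ hab _).2).trans ?_
    have h := (LipschitzWith.projIcc hab).dist_le_mul (a + s) (a + t)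
    simpa [Subtype.dist_eq] using h
  · simp
  · simp

theorem UnitPath.mono {S : Set M} {x y : M} {L L' : ℝ} (h : UnitPath S x y L) (hL : 0 ≤ L)
    (hLL' : L ≤ L') : UnitPath S x y L' := by
  obtain ⟨f, hf, rfl, rfl, hS⟩ := h
  refine ⟨fun t => f (min t L), ?_, by simp [hL], by simp [hLL'], fun t => hS _⟩
  simpa only [mul_one] using! hf.comp (LipschitzWith.id.min_const L)

theorem UnitPath.symm {S : Set M} {x y : M} {L : ℝ} (h : UnitPath S x y L) :
    UnitPath S y x L := by
  obtain ⟨f, hf, rfl, rfl, hS⟩ := h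
  refine ⟨fun t => f (L - t), ?_, by simp, by simp, fun t => hS _⟩
  refine LipschitzWith.of_dist_le_mul fun s t => (hf.dist_le_mul _ _).trans ?_
  simp only [NNReal.coe_one, one_mul, dist_sub_left, le_refl]

theorem UnitPath.trans {S : Set M} {x y z : M} {L L' : ℝ} (h : UnitPath S x y L)
    (h' : UnitPath S y z L') (hL : 0 ≤ L) (hL' : 0 ≤ L') : UnitPath S x z (L + L') := by
  obtain ⟨f, hf, rfl, rfl, hS⟩ := h
  obtain ⟨g, hg, hg0, rfl, hS'⟩ := h'
  let h : ℝ → M := fun t => if t ≤ L then f t else g (t - L)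
  have h_le : ∀ t, t ≤ L → h t = f t := fun t ht => if_pos ht
  have h_ge : ∀ t, L ≤ t → h t = g (t - L) := fun t ht => by
    rcases ht.eq_or_lt with rfl | ht
    · simp [h, hg0]
    · exact if_neg ht.not_ge
  refine ⟨h, LipschitzWith.of_dist_le_mul fun s t => ?_, h_le _ hL, ?_, fun t => ?_⟩
  · wlog hst : s ≤ t generalizing s t
    · rw [dist_comm, dist_comm s]
      exact this t s (le_of_not_ge hst)
    rcases le_total t L with htL | htL
    · rw [h_le s (hst.trans htL), h_le t htL]
      exact hf.dist_le_mul _ _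
    rcases le_total s L with hsL | hsL
    · have h1 := hf.dist_le_mul s L
      have h2 := hg.dist_le_mul 0 (t - L)
      have h3 := dist_triangle (f s) (f L) (g (t - L))
      rw [h_le s hsL, h_ge t htL]
      rw [hg0] at h2
      simp only [NNReal.coe_one, one_mul, Real.dist_eq] at h1 h2 ⊢
      rw [abs_of_nonpos (by linarith)] at h1 h2 ⊢
      linarith
    · rw [h_ge s hsL, h_ge t htL]
      simpa using hg.dist_le_mul (s - L) (t - L)
  · rw [h_ge _ (by linarith), add_sub_cancel_left]
  · by_cases ht : t ≤ L
    · rw [h_le t ht]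
      exact hS t
    · rw [h_ge t (le_of_not_ge ht)]
      exact hS' _

/-- Limits of unit paths avoiding an increasing sequence of open sets. -/
theorem UnitPath.iUnion_of_tendsto [ProperSpace M] {S : ℕ → Set M} (hS : ∀ n, IsOpen (S n))
    (hmono : Monotone S) {x : ℕ → M} {y x₀ : M} {L : ℕ → ℝ} {L₀ : ℝ}
    (h : ∀ n, UnitPath (S n) (x n) y (L n)) (hx : Tendsto x atTop (nhds x₀))
    (hL : Tendsto L atTop (nhds L₀)) : UnitPath (⋃ n, S n) x₀ y L₀ := by
  choose f hf hf0 hfL hfS using h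
  obtain ⟨C, hC⟩ := (Metric.isBounded_range_of_tendsto x hx).subset_closedBall x₀
  have hK : IsCompact (Set.pi univ fun t : ℝ => closedBall x₀ (|t| + C)) :=
    isCompact_univ_pi fun t => isCompact_closedBall _ _
  have hmem : ∀ n, f n ∈ Set.pi univ fun t : ℝ => closedBall x₀ (|t| + C) := fun n t _ => by
    have h1 := (hf n).dist_le_mul t 0
    have h2 : dist (x n) x₀ ≤ C := hC (mem_range_self n)
    have h3 := dist_triangle (f n t) (x n) x₀
    rw [hf0] at h1
    simp only [NNReal.coe_one, one_mul, Real.dist_eq, sub_zero] at h1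
    exact mem_closedBall.2 (by linarith)
  let U : Ultrafilter ℕ := hyperfilter ℕ
  have hU : (U : Filter ℕ) ≤ atTop := Nat.hyperfilter_le_atTop
  obtain ⟨g, -, hg⟩ := hK.ultrafilter_le_nhds (U.map f)
    (le_principal_iff.2 (mem_map.2 (Filter.univ_mem' hmem)))
  have hg' : Tendsto f U (nhds g) := hg
  have hlim : ∀ t, Tendsto (fun n => f n t) U (nhds (g t)) := tendsto_pi_nhds.1 hg'
  refine ⟨g, LipschitzWith.of_dist_le_mul fun s t => ?_, ?_, ?_, fun t => ?_⟩
  · exact le_of_tendsto ((hlim s).dist (hlim t)) (Eventually.of_forall fun n =>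
      (hf n).dist_le_mul s t)
  · refine tendsto_nhds_unique (hlim 0) ?_
    simpa only [hf0] using hx.mono_left hU
  · have h1 : Tendsto (fun n => dist (f n L₀) y) U (nhds (dist (g L₀) y)) :=
      (hlim L₀).dist tendsto_const_nhds
    have h2 : Tendsto (fun n => dist L₀ (L n)) U (nhds (dist L₀ L₀)) :=
      tendsto_const_nhds.dist (hL.mono_left hU)
    have h3 := le_of_tendsto_of_tendsto h1 h2 (Eventually.of_forall fun n => by
      simpa [hfL] using (hf n).dist_le_mul L₀ (L n))
    rw [dist_self] at h3
    exact dist_le_zero.1 h3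
  · rw [mem_iUnion]
    rintro ⟨m, hm⟩
    refine (hS m).isClosed_compl.mem_of_tendsto (hlim t) ?_ hm
    filter_upwards [hU (eventually_ge_atTop m)] with n hn hmn
    exact hfS n t (hmono hn hmn)

theorem UnitPath.of_tendsto [ProperSpace M] {S : Set M} (hS : IsOpen S) {x : ℕ → M} {y x₀ : M}
    {L : ℕ → ℝ} {L₀ : ℝ} (h : ∀ n, UnitPath S (x n) y (L n)) (hx : Tendsto x atTop (nhds x₀))
    (hL : Tendsto L atTop (nhds L₀)) : UnitPath S x₀ y L₀ := by
  simpa only [iUnion_const] using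
    UnitPath.iUnion_of_tendsto (fun _ : ℕ => hS) monotone_const h hx hL

/-- Arc-length parametrization of a Lipschitz path. -/
theorem UnitPath.of_eVariationOn_le {S : Set M} {γ : ℝ → M} {K : ℝ≥0} {T L : ℝ} (hT : 0 ≤ T)
    (hγ : LipschitzOnWith K γ (Icc 0 T)) (hS : ∀ t ∈ Icc 0 T, γ t ∉ S) (hL : 0 ≤ L)
    (hvar : eVariationOn γ (Icc 0 T) ≤ ENNReal.ofReal L) : UnitPath S (γ 0) (γ T) L := by
  have h0 : (0 : ℝ) ∈ Icc 0 T := left_mem_Icc.2 hT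
  have h1 : T ∈ Icc 0 T := right_mem_Icc.2 hT
  have hbv : BoundedVariationOn γ (Icc 0 T) := (hvar.trans_lt ENNReal.ofReal_lt_top).ne
  have hlbv := hbv.locallyBoundedVariationOn
  set V : ℝ → ℝ := variationOnFromTo γ (Icc 0 T) 0 with hV
  have hsub : ∀ a ∈ Icc 0 T, ∀ b ∈ Icc 0 T, a ≤ b →
      V b - V a = (eVariationOn γ (Icc 0 T ∩ Icc a b)).toReal := fun a ha b hb hab => by
    rw [hV, variationOnFromTo.sub_right hlbv h0 hb ha, variationOnFromTo.eq_of_le _ _ hab]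
  have hdist : ∀ a ∈ Icc 0 T, ∀ b ∈ Icc 0 T, dist (γ a) (γ b) ≤ |V a - V b| := by
    intro a ha b hb
    wlog hab : a ≤ b generalizing a b
    · rw [dist_comm, abs_sub_comm]
      exact this b hb a ha (le_of_not_ge hab)
    rw [abs_sub_comm]
    refine le_trans ?_ (le_abs_self _)
    rw [hsub a ha b hb hab, dist_edist]
    exact ENNReal.toReal_mono (hlbv a b ha hb)
      (eVariationOn.edist_le _ ⟨ha, le_rfl, hab⟩ ⟨hb, hab, le_rfl⟩)
  have hcont : ContinuousOn V (Icc 0 T) := by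
    refine LipschitzOnWith.continuousOn (K := K) (LipschitzOnWith.of_dist_le_mul ?_)
    intro a ha b hb
    wlog hab : a ≤ b generalizing a b
    · rw [dist_comm, dist_comm a]
      exact this b hb a ha (le_of_not_ge hab)
    have h2 : eVariationOn γ (Icc 0 T ∩ Icc a b) ≤ ENNReal.ofReal (K * (b - a)) := by
      have h3 := (hγ.mono inter_subset_left).comp_eVariationOn_le (mapsTo_id (Icc 0 T ∩ Icc a b))
      have h4 := (monotoneOn_id (s := Icc (0 : ℝ) T)).eVariationOn_eq ha hb
      rw [Function.comp_id] at h3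
      refine h3.trans ?_
      rw [h4, ENNReal.ofReal_mul K.coe_nonneg, id, id]
      exact (congrArg (· * _) ENNReal.ofReal_coe_nnreal.symm).le
    rw [dist_comm, Real.dist_eq, dist_comm, Real.dist_eq, abs_of_nonneg (sub_nonneg.2 hab),
      hsub a ha b hb hab, abs_of_nonneg ENNReal.toReal_nonneg]
    exact ENNReal.toReal_le_of_le_ofReal (mul_nonneg K.coe_nonneg (sub_nonneg.2 hab)) h2
  have hV0 : V 0 = 0 := variationOnFromTo.self _ _ _
  have hVT : 0 ≤ V T := variationOnFromTo.nonneg_of_le _ _ hT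
  have hVL : V T ≤ L := by
    have h2 := hsub 0 h0 T h1 hT
    rw [hV0, sub_zero, inter_self] at h2
    rw [h2]
    exact ENNReal.toReal_le_of_le_ofReal hL hvar
  have hsurj : ∀ u : ℝ, ∃ t ∈ Icc 0 T, V t = projIcc 0 (V T) hVT u := fun u => by
    have h2 := intermediate_value_Icc hT hcont
    rw [hV0] at h2
    exact h2 (projIcc 0 (V T) hVT u).2
  choose σ hσ hVσ using hsurj
  refine ⟨γ ∘ σ, LipschitzWith.of_dist_le_mul fun s t => ?_, ?_, ?_, fun t => hS _ (hσ t)⟩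
  · refine (hdist _ (hσ s) _ (hσ t)).trans ?_
    rw [hVσ, hVσ]
    exact (LipschitzWith.projIcc hVT).dist_le_mul s t
  · have h2 := hdist _ (hσ 0) _ h0
    rw [hVσ, hV0, projIcc_left] at h2
    exact dist_le_zero.1 (by simpa using h2)
  · have h2 := hdist _ (hσ L) _ h1
    rw [hVσ, projIcc_of_right_le _ hVL] at h2
    exact dist_le_zero.1 (by simpa using h2)

theorem dCompl_le_iff_unitPath [ProperSpace M] {S : Set M} (hS : IsOpen S) {x y : M} {L : ℝ}
    (hL : 0 ≤ L) : dCompl S x y ≤ ENNReal.ofReal L ↔ UnitPath S x y L := by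
  constructor
  · intro h
    have hstep : ∀ n : ℕ, UnitPath S x y (L + 1 / ((n : ℝ) + 1)) := fun n => by
      have hpos : (0 : ℝ) < 1 / ((n : ℝ) + 1) := by positivity
      have hlt : dCompl S x y < ENNReal.ofReal (L + 1 / ((n : ℝ) + 1)) :=
        h.trans_lt ((ENNReal.ofReal_lt_ofReal_iff (by linarith)).2 (by linarith))
      obtain ⟨ℓ, ⟨T, γ, hT, rfl, rfl, ⟨K, hK⟩, hav, rfl⟩, hℓ⟩ := sInf_lt_iff.1 hlt
      exact .of_eVariationOn_le hT hK hav (by linarith) hℓ.le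
    refine .of_tendsto hS hstep tendsto_const_nhds ?_
    simpa using tendsto_const_nhds.add (tendsto_one_div_add_atTop_nhds_zero_nat (𝕜 := ℝ))
  · rintro ⟨f, hf, hf0, hfL, hav⟩
    have hle : dCompl S x y ≤ pathLength f L :=
      sInf_le ⟨L, f, hL, hf0, hfL, ⟨1, hf.lipschitzOnWith⟩, fun t _ => hav t, rfl⟩
    refine hle.trans ?_
    have h1 := (hf.lipschitzOnWith (s := Icc 0 L)).comp_eVariationOn_le (mapsTo_id (Icc 0 L))
    have h2 := (monotoneOn_id (s := Icc (0 : ℝ) L)).eVariationOn_eq (left_mem_Icc.2 hL)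
      (right_mem_Icc.2 hL)
    rw [inter_self] at h2
    rw [Function.comp_id, h2] at h1
    simpa [pathLength] using h1

section Omega

variable {p q : M} {lam : ℝ}

theorem omegaSeq_monotone : Monotone (OmegaSeq p q lam) :=
  monotone_nat_of_le_succ fun _ => subset_union_left

theorem mem_omega_iff {x : M} : x ∈ Omega p q lam ↔ ∃ n, x ∈ OmegaSeq p q lam n := by
  rw [Omega, mem_iUnion]
  exact ⟨fun ⟨n, hn⟩ => ⟨n + 1, hn⟩, fun ⟨n, hn⟩ => ⟨n, omegaSeq_monotone n.le_succ hn⟩⟩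

/-- The distance to `p` along a minimizing geodesic issued from `p`. -/
theorem dist_of_geodesic {x : M} {η : ℝ → M} (hη : LipschitzWith 1 η) (h0 : η 0 = p)
    (hx : η (dist x p) = x) {s : ℝ} (hs : s ∈ Icc 0 (dist x p)) : dist (η s) p = s := by
  have h1 := hη.dist_le_mul s 0
  have h2 := hη.dist_le_mul (dist x p) s
  have h3 := dist_triangle x (η s) p
  rw [hx] at h2
  rw [h0] at h1
  simp only [NNReal.coe_one, one_mul, Real.dist_eq, sub_zero] at h1 h2
  rw [abs_of_nonneg hs.1] at h1
  rw [abs_of_nonneg (sub_nonneg.2 hs.2)] at h2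
  linarith

variable [ProperSpace M]

theorem notMem_omegaSeq_succ_iff (hlam : 0 ≤ lam) {n : ℕ} (hn : IsOpen (OmegaSeq p q lam n))
    {x : M} : x ∉ OmegaSeq p q lam (n + 1) ↔
      UnitPath (OmegaSeq p q lam n) x q (lam * dist x p) := by
  rw [← dCompl_le_iff_unitPath hn (by positivity), OmegaSeq]
  simp only [mem_union, mem_ofPred_eq, not_or, not_and, not_lt]
  refine ⟨fun h => h.2 h.1, fun h => ⟨?_, fun _ => h⟩⟩
  obtain ⟨f, -, rfl, -, hf⟩ := (dCompl_le_iff_unitPath hn (by positivity)).1 h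
  exact hf 0

theorem isOpen_omegaSeq (hlam : 0 ≤ lam) (n : ℕ) : IsOpen (OmegaSeq p q lam n) := by
  induction n with
  | zero => exact isOpen_empty
  | succ n ih =>
    refine isClosed_compl_iff.1 (IsSeqClosed.isClosed fun x x₀ hx hlim => ?_)
    exact (notMem_omegaSeq_succ_iff hlam ih).2 <|
      .of_tendsto ih (fun k => (notMem_omegaSeq_succ_iff hlam ih).1 (hx k)) hlim
        ((hlim.dist tendsto_const_nhds).const_mul lam)

theorem isOpen_omega (hlam : 0 ≤ lam) : IsOpen (Omega p q lam) :=
  isOpen_iUnion fun n => isOpen_omegaSeq hlam (n + 1)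

/-- `Ω_n` is star-shaped about `p`. -/
theorem geodesic_mem_omegaSeq (hlam : 1 ≤ lam) (n : ℕ) {x : M} {η : ℝ → M}
    (hη : LipschitzWith 1 η) (h0 : η 0 = p) (hx : η (dist x p) = x)
    (hmem : x ∈ OmegaSeq p q lam n) {s : ℝ} (hs : s ∈ Icc 0 (dist x p)) :
    η s ∈ OmegaSeq p q lam n := by
  induction n generalizing x s with
  | zero => exact hmem.elim
  | succ n ih =>
    have hlam0 : 0 ≤ lam := by linarith
    have hn := isOpen_omegaSeq (p := p) (q := q) hlam0 n
    by_contra hns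
    refine (notMem_omegaSeq_succ_iff hlam0 hn).2 ?_ hmem
    have hpath := (notMem_omegaSeq_succ_iff hlam0 hn).1 hns
    rw [dist_of_geodesic hη h0 hx hs] at hpath
    have hav : ∀ t ∈ Icc s (dist x p), η t ∉ OmegaSeq p q lam n := fun t ht hmt => by
      have hdt := dist_of_geodesic hη h0 hx ⟨hs.1.trans ht.1, ht.2⟩
      exact hns (omegaSeq_monotone n.le_succ
        (ih (x := η t) (by rw [hdt]) hmt ⟨hs.1, by rw [hdt]; exact ht.1⟩))
    have hseg := (UnitPath.of_Icc hs.2 hη.lipschitzOnWith hav).symm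
    rw [hx] at hseg
    have hls : 0 ≤ lam * s := mul_nonneg hlam0 hs.1
    refine (hseg.trans hpath (sub_nonneg.2 hs.2) hls).mono
      (add_nonneg (sub_nonneg.2 hs.2) hls) ?_
    nlinarith [hs.2]

theorem unitPath_of_notMem_omega (hlam : 0 ≤ lam) {x : M} (hx : x ∉ Omega p q lam) :
    UnitPath (Omega p q lam) x q (lam * dist x p) := by
  refine UnitPath.iUnion_of_tendsto (fun n => isOpen_omegaSeq hlam (n + 1))
    (fun m n h => omegaSeq_monotone (Nat.succ_le_succ h)) (fun n => ?_) tendsto_const_nhds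
    tendsto_const_nhds
  exact (notMem_omegaSeq_succ_iff hlam (isOpen_omegaSeq hlam _)).1
    fun h => hx (mem_omega_iff.2 ⟨_, h⟩)

end Omega

theorem UnitPath.exists_minimal [ProperSpace M] {S : Set M} (hS : IsOpen S) {x y : M} {L : ℝ}
    (hL : 0 ≤ L) (h : UnitPath S x y L) :
    ∃ D, 0 ≤ D ∧ UnitPath S x y D ∧ ∀ L', 0 ≤ L' → UnitPath S x y L' → D ≤ L' := by
  let s : Set ℝ := {L | 0 ≤ L ∧ UnitPath S x y L}
  have hbdd : BddBelow s := ⟨0, fun _ h => h.1⟩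
  obtain ⟨u, -, hu, hus⟩ := exists_seq_tendsto_sInf (S := s) ⟨L, hL, h⟩ hbdd
  exact ⟨sInf s, Real.sInf_nonneg fun _ h => h.1,
    .of_tendsto hS (fun n => (hus n).2) tendsto_const_nhds hu,
    fun L' h0 h' => csInf_le hbdd ⟨h0, h'⟩⟩

namespace IsGrowthCompetition

variable {p q : M} {lam : ℝ} {A B : ℝ → Set M}

/-- The points of a path avoiding `B` are reached in due time by `A`. -/
theorem mem_A_of_avoidsB (h : IsGrowthCompetition p q lam A B) {t s : ℝ} {γ : ℝ → M}
    (hγ : AvoidsB q lam B t γ) (hs : s ∈ Icc 0 t) : γ s ∈ A s := by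
  rcases hs.1.eq_or_lt with rfl | hs0
  · rw [h.A_zero, hγ.1, mem_singleton_iff]
  · rw [h.A_eq s hs0]
    have hsub : Icc 0 s ⊆ Icc 0 t := Icc_subset_Icc_right hs.2
    exact ⟨γ, ⟨hγ.1, hγ.2.1.mono hsub, fun r hr => hγ.2.2 r (hsub hr)⟩, s, ⟨hs.1, le_rfl⟩, rfl⟩

theorem mem_B_of_avoidsA (h : IsGrowthCompetition p q lam A B) {t s r : ℝ} {η : ℝ → M}
    (hη : AvoidsA p A t η) (hr : 0 ≤ r) (hrs : r < s) (hst : s ≤ t) : η r ∈ B s := by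
  rw [h.B_eq s (hr.trans_lt hrs)]
  have hsub : Icc 0 s ⊆ Icc 0 t := Icc_subset_Icc_right hst
  exact ⟨η, ⟨hη.1, hη.2.1.mono hsub, fun u hu => hη.2.2 u (hsub hu)⟩, r, ⟨hr, hrs⟩, rfl⟩

/-- Every point of `A t` lies on a path avoiding `B`. -/
theorem exists_avoidsB (h : IsGrowthCompetition p q lam A B) (hpq : p ≠ q) {t : ℝ} (ht : 0 ≤ t)
    {x : M} (hx : x ∈ A t) :
    ∃ s ∈ Icc 0 t, ∃ γ, AvoidsB q lam B s γ ∧ γ s = x := by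
  rcases ht.eq_or_lt with rfl | ht
  · rw [h.A_zero, mem_singleton_iff] at hx
    refine ⟨0, ⟨le_rfl, le_rfl⟩, fun _ => q, ⟨rfl, ?_, fun s hs => ?_⟩, hx.symm⟩
    · exact (LipschitzWith.const' q).lipschitzOnWith
    · rw [le_antisymm hs.2 hs.1, h.B_zero]
      exact hpq.symm
  · rw [h.A_eq t ht] at hx
    obtain ⟨γ, hγ, s, hs, rfl⟩ := hx
    have hsub : Icc 0 s ⊆ Icc 0 t := Icc_subset_Icc_right hs.2
    exact ⟨s, hs, γ, ⟨hγ.1, hγ.2.1.mono hsub, fun r hr => hγ.2.2 r (hsub hr)⟩, rfl⟩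

theorem exists_avoidsA (h : IsGrowthCompetition p q lam A B) {t : ℝ} (ht : 0 < t)
    {x : M} (hx : x ∈ B t) : ∃ r ∈ Ico 0 t, ∃ η, AvoidsA p A t η ∧ η r = x := by
  rw [h.B_eq t ht] at hx
  obtain ⟨η, hη, r, hr, rfl⟩ := hx
  exact ⟨r, hr, η, hη, rfl⟩

theorem dist_lt_of_mem_B (h : IsGrowthCompetition p q lam A B) {t : ℝ} (ht : 0 < t)
    {x : M} (hx : x ∈ B t) : dist x p < t := by
  obtain ⟨r, hr, η, ⟨rfl, hη, -⟩, rfl⟩ := h.exists_avoidsA ht hx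
  have h1 := hη.dist_le_mul r ⟨hr.1, hr.2.le⟩ 0 ⟨le_rfl, ht.le⟩
  simp only [NNReal.coe_one, one_mul, Real.dist_eq, sub_zero, abs_of_nonneg hr.1] at h1
  exact h1.trans_lt hr.2

theorem disjoint_Ainfty_Binfty (h : IsGrowthCompetition p q lam A B) (hpq : p ≠ q) :
    Disjoint (Ainfty A) (Binfty B) := by
  refine Set.disjoint_left.2 fun x hA hB => ?_
  simp only [Ainfty, Binfty, mem_iUnion, mem_Ici, exists_prop] at hA hB
  obtain ⟨t, ht, hxA⟩ := hA
  obtain ⟨t', ht', hxB⟩ := hB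
  obtain ⟨s, hs, γ, hγ, rfl⟩ := h.exists_avoidsB hpq ht hxA
  obtain ⟨r, hr, η, hη, hrs⟩ := h.exists_avoidsA (by linarith : 0 < t' + 1)
    (h.monoB ht' (by linarith) hxB)
  rcases le_or_gt s r with hsr | hrs'
  · refine hη.2.2 r ⟨hr.1, hr.2.le⟩ ?_
    rw [hrs]
    exact h.monoA hs.1 hsr (h.mem_A_of_avoidsB hγ ⟨hs.1, le_rfl⟩)
  · refine hγ.2.2 s ⟨hs.1, le_rfl⟩ ?_
    rw [← hrs]
    rcases le_total s (t' + 1) with hst | hst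
    · exact h.mem_B_of_avoidsA hη hr.1 hrs' hst
    · exact h.monoB (by linarith) hst (h.mem_B_of_avoidsA hη hr.1 hr.2 le_rfl)

/-- Points of `A t` are joined to `q` in time `λ t` outside any subset of `B_∞`. -/
theorem unitPath_of_mem_A (h : IsGrowthCompetition p q lam A B) (hpq : p ≠ q) (hlam : 0 < lam)
    {S : Set M} (hS : S ⊆ Binfty B) {t : ℝ} (ht : 0 ≤ t) {x : M} (hx : x ∈ A t) :
    UnitPath S x q (lam * t) := by
  obtain ⟨s, hs, γ, hγ, rfl⟩ := h.exists_avoidsB hpq ht hx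
  have hls : 0 ≤ lam * s := mul_nonneg hlam.le hs.1
  have hdiv : ∀ u ∈ Icc 0 (lam * s), u / lam ∈ Icc 0 s := fun u hu =>
    ⟨div_nonneg hu.1 hlam.le, (div_le_iff₀' hlam).2 hu.2⟩
  have hpath : UnitPath S (γ (0 / lam)) (γ (lam * s / lam)) (lam * s - 0) := by
    refine UnitPath.of_Icc (f := fun u => γ (u / lam)) hls
      (LipschitzOnWith.of_dist_le_mul fun u hu v hv => ?_) fun u hu hmem => ?_
    · refine (hγ.2.1.dist_le_mul _ (hdiv u hu) _ (hdiv v hv)).trans ?_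
      rw [Real.coe_toNNReal _ hlam.le, Real.dist_eq, ← _root_.sub_div, abs_div, abs_of_pos hlam,
        mul_div_cancel₀ _ hlam.ne', NNReal.coe_one, one_mul, Real.dist_eq]
    · refine Set.disjoint_left.1 (h.disjoint_Ainfty_Binfty hpq) ?_ (hS hmem)
      exact mem_biUnion (hdiv u hu).1 (h.mem_A_of_avoidsB hγ (hdiv u hu))
  rw [zero_div, hγ.1, mul_div_cancel_left₀ _ hlam.ne', sub_zero] at hpath
  exact hpath.symm.mono hls (mul_le_mul_of_nonneg_left hs.2 hlam.le)

theorem omegaSeq_subset_Binfty [ProperSpace M] (hM : IsLengthSpace M)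
    (h : IsGrowthCompetition p q lam A B) (hpq : p ≠ q) (hlam : 1 ≤ lam) (n : ℕ) :
    OmegaSeq p q lam n ⊆ Binfty B := by
  have hlam0 : 0 < lam := by linarith
  induction n with
  | zero => exact empty_subset _
  | succ n ih =>
    intro x hx
    have hn := isOpen_omegaSeq (p := p) (q := q) hlam0.le n
    have hnot : ∀ {y}, y ∈ OmegaSeq p q lam (n + 1) →
        ¬ UnitPath (OmegaSeq p q lam n) y q (lam * dist y p) := fun hy hpath =>
      (notMem_omegaSeq_succ_iff hlam0.le hn).2 hpath hy
    obtain ⟨t, hdt, ht⟩ : ∃ t, dist x p < t ∧ ¬ UnitPath (OmegaSeq p q lam n) x q (lam * t) := by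
      by_contra! hcon
      refine hnot hx (.of_tendsto hn
        (fun k : ℕ => hcon (dist x p + 1 / ((k : ℝ) + 1)) ?_) tendsto_const_nhds ?_)
      · have : (0 : ℝ) < 1 / ((k : ℝ) + 1) := by positivity
        linarith
      · simpa using (tendsto_const_nhds.add
          (tendsto_one_div_add_atTop_nhds_zero_nat (𝕜 := ℝ))).const_mul lam
    have hd : 0 ≤ dist x p := dist_nonneg
    obtain ⟨η, hη, h0, hηx, -⟩ := ((dCompl_le_iff_unitPath isOpen_empty hd).1 (hM x p).ge).symm
    let η' : ℝ → M := fun s => η (min s (dist x p))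
    have hη' : AvoidsA p A t η' := by
      refine ⟨by simp [η', h0], ?_, fun s hs hmem => ?_⟩
      · refine LipschitzWith.lipschitzOnWith ?_
        simpa only [mul_one] using! hη.comp (LipschitzWith.id.min_const (dist x p))
      have hpath := h.unitPath_of_mem_A hpq hlam0 ih hs.1 hmem
      rcases le_total s (dist x p) with hsd | hds
      · simp only [η', min_eq_left hsd] at hpath
        refine hnot (geodesic_mem_omegaSeq hlam _ hη h0 hηx hx ⟨hs.1, hsd⟩) ?_
        rwa [dist_of_geodesic hη h0 hηx ⟨hs.1, hsd⟩]
      · simp only [η', min_eq_right hds, hηx] at hpath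
        exact ht (hpath.mono (mul_nonneg hlam0.le hs.1) (mul_le_mul_of_nonneg_left hs.2 hlam0.le))
    have hxB := h.mem_B_of_avoidsA hη' hd hdt le_rfl
    simp only [η', min_self, hηx] at hxB
    exact mem_biUnion (hd.trans hdt.le) hxB

theorem compl_omega_subset_Ainfty [ProperSpace M] (h : IsGrowthCompetition p q lam A B)
    (hpq : p ≠ q) (hlam : 0 < lam) : (Omega p q lam)ᶜ ⊆ Ainfty A := by
  intro x hx
  obtain ⟨D, hD, ⟨f, hf, rfl, hfD, hfav⟩, hmin⟩ := UnitPath.exists_minimal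
    (isOpen_omega hlam.le) (by positivity) (unitPath_of_notMem_omega hlam.le hx)
  have hav : ∀ s, lam * s ≤ D → 0 ≤ s → f (D - lam * s) ∉ B s := by
    intro s hsD hs hB
    have hle : s ≤ dist (f (D - lam * s)) p := by
      have h1 : UnitPath (Omega p q lam) (f 0) (f (D - lam * s)) (D - lam * s) :=
        ⟨f, hf, rfl, rfl, hfav⟩
      have h2 := unitPath_of_notMem_omega hlam.le (hfav (D - lam * s))
      have h3 : 0 ≤ lam * dist (f (D - lam * s)) p := by positivity
      have h4 := hmin _ (add_nonneg (sub_nonneg.2 hsD) h3) (h1.trans h2 (sub_nonneg.2 hsD) h3)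
      exact le_of_mul_le_mul_left (by linarith) hlam
    rcases hs.eq_or_lt with rfl | hs
    · rw [h.B_zero, mem_singleton_iff, mul_zero, sub_zero, hfD] at hB
      exact hpq hB.symm
    · exact (h.dist_lt_of_mem_B hs hB).not_ge hle
  have hmul : lam * (D / lam) = D := mul_div_cancel₀ D hlam.ne'
  have hγ : AvoidsB q lam B (D / lam) fun s => f (D - lam * s) := by
    refine ⟨by simp [hfD], ?_, fun s hs => hav s ?_ hs.1⟩
    · refine (LipschitzWith.of_dist_le_mul fun s t => (hf.dist_le_mul _ _).trans ?_).lipschitzOnWith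
      rw [dist_sub_left, NNReal.coe_one, one_mul, Real.coe_toNNReal _ hlam.le, Real.dist_eq,
        ← mul_sub, abs_mul, abs_of_pos hlam, Real.dist_eq]
    · exact (mul_le_mul_of_nonneg_left hs.2 hlam.le).trans hmul.le
  have hDl : 0 ≤ D / lam := div_nonneg hD hlam.le
  have hA := h.mem_A_of_avoidsB hγ ⟨hDl, le_rfl⟩
  simp only [hmul, sub_self] at hA
  exact mem_biUnion hDl hA

end IsGrowthCompetition

/-- Proposition 2.7.  For any growth competition
`{A_t, B_t}` between `p` and `q`, one has `B_∞ = Ω` and `A_∞ = M ∖ Ω`. -/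
theorem Binfty_eq_Omega
    {M : Type*} [MetricSpace M] [ProperSpace M] (hM : IsLengthSpace M)
    (p q : M) (hpq : p ≠ q) (lam : ℝ) (hlam : 1 < lam)
    (A B : ℝ → Set M) (hcomp : IsGrowthCompetition p q lam A B) :
    Binfty B = Omega p q lam ∧ Ainfty A = (Omega p q lam)ᶜ := by
  have hdisj := hcomp.disjoint_Ainfty_Binfty hpq
  have hΩB : Omega p q lam ⊆ Binfty B :=
    iUnion_subset fun n => hcomp.omegaSeq_subset_Binfty hM hpq hlam.le (n + 1)
  have hΩA : (Omega p q lam)ᶜ ⊆ Ainfty A :=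
    hcomp.compl_omega_subset_Ainfty hpq (by linarith)
  exact ⟨(compl_subset_compl.1 (hΩA.trans hdisj.subset_compl_right)).antisymm hΩB,
    (hdisj.subset_compl_right.trans (compl_subset_compl.2 hΩB)).antisymm hΩA⟩

end GrowthComp
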